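/- arXiv:2304.11894 — 2 statements merged into one kernel-verified Lean document; each statement's English description precedes it below -/
import Mathlib

section
/- Let g, ĝ : E → ℝ be functions on a set E and let γ ≥ 0. Define the failure domain Ω_f = {z ∈ E : g(z) < 0} and the hybrid approximate failure domain Ω̃_f = {z : ĝ(z) < −γ} ∪ ({z : |ĝ(z)| ≤ γ} ∩ {z : g(z) < 0}). Then the symmetric difference Ω_f Δ Ω̃_f is contained in the set {z ∈ E : |g(z) − ĝ(z)| > γ}. -/
/-- The symmetric difference between the failure domain `Ω_f = {g < 0}` and the hybrid
approximate failure domain `Ω̃_f = {ĝ < -γ} ∪ ({|ĝ| ≤ γ} ∩ {g < 0})` is contained in the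
set where `|g - ĝ| > γ`. -/
theorem hybrid_symmDiff_subset {E : Type*} (g ghat : E → ℝ) (γ : ℝ) (hγ : 0 ≤ γ) :
    symmDiff {z | g z < 0}
        ({z | ghat z < -γ} ∪ ({z | |ghat z| ≤ γ} ∩ {z | g z < 0}))
      ⊆ {z | |g z - ghat z| > γ} := by
  rintro z (⟨hg, hn⟩ | ⟨h | ⟨_, hg⟩, hn⟩)
  · simp only [Set.mem_union, Set.mem_inter_iff, Set.mem_ofPred_eq, not_or, not_and, not_lt]
      at hg hn ⊢
    have hghat : γ < ghat z := by
      by_contra! hle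
      exact absurd (hn.2 (abs_le.mpr ⟨hn.1, hle⟩)) (not_le.mpr hg)
    exact lt_abs.mpr (Or.inr (by linarith))
  · simp only [Set.mem_ofPred_eq, not_lt] at h hn ⊢
    exact lt_abs.mpr (Or.inl (by linarith))
  · exact absurd hg hn
end

section
/- Let (E, ℰ, μ) be a probability space, let g, ĝ : E → ℝ be measurable with g − ĝ ∈ L^p(μ) for some p ≥ 1, and define the failure probability P_f = μ({z : g(z) < 0}). For γ ≥ 0 define the hybrid failure probability P_f^h(γ) = μ({z : ĝ(z) < −γ} ∪ ({z : |ĝ(z)| ≤ γ} ∩ {z : g(z) < 0})). Then for every ε > 0, setting γ_N = ε^{−1/p} ‖g − ĝ‖_{L^p_μ}, one has |P_f − P_f^h(γ)| < ε for all γ > γ_N. -/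
open MeasureTheory

/-- If `g` and `ghat` are less than `γ` apart at `z`, the hybrid failure domain classifies `z`
correctly. -/
theorem symmDiff_hybrid_failure_domain_subset {E : Type*} (g ghat : E → ℝ) (γ : ℝ) :
    symmDiff {z | g z < 0} ({z | ghat z < -γ} ∪ ({z | |ghat z| ≤ γ} ∩ {z | g z < 0})) ⊆
      {z | γ ≤ |g z - ghat z|} := by
  rintro z (⟨hA, hB⟩ | ⟨hB, hA⟩)
  · simp only [Set.mem_union, Set.mem_inter_iff, Set.mem_ofPred_eq, not_or, not_and, not_lt]
      at hA hB ⊢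
    have hlarge : γ < ghat z := by
      by_contra! h
      exact absurd hA (hB.2 (abs_le.2 ⟨hB.1, h⟩)).not_gt
    rw [abs_sub_comm]
    exact le_trans (by linarith) (le_abs_self _)
  · simp only [Set.mem_union, Set.mem_inter_iff, Set.mem_ofPred_eq, not_lt] at hA hB ⊢
    rcases hB with hB | hB
    · exact le_trans (by linarith) (le_abs_self _)
    · linarith [hB.2]

/-- Markov's inequality for the `p`-th power, with the threshold in terms of the `L^p` norm. -/
theorem measureReal_abs_ge_lt {E : Type*} [MeasurableSpace E] {μ : Measure E} {f : E → ℝ}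
    {p ε γ : ℝ} (hp : 0 < p) (hf : Integrable (fun z => |f z| ^ p) μ) (hε : 0 < ε)
    (hγ : ε ^ (-(1 / p)) * (∫ z, |f z| ^ p ∂μ) ^ (1 / p) < γ) :
    μ.real {z | γ ≤ |f z|} < ε := by
  have hI : 0 ≤ ∫ z, |f z| ^ p ∂μ := integral_nonneg fun z => by positivity
  have hγ_pos : 0 < γ := lt_of_le_of_lt (by positivity) hγ
  have hpow : ε⁻¹ * ∫ z, |f z| ^ p ∂μ < γ ^ p := by
    have h := Real.rpow_lt_rpow (by positivity) hγ hp
    rwa [Real.mul_rpow (by positivity) (by positivity), ← Real.rpow_mul hε.le,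
      ← Real.rpow_mul hI, neg_mul, one_div_mul_cancel hp.ne', Real.rpow_one,
      Real.rpow_neg_one] at h
  have hset : {z | γ ≤ |f z|} = {z | γ ^ p ≤ |f z| ^ p} := by
    ext z
    exact (Real.rpow_le_rpow_iff hγ_pos.le (abs_nonneg _) hp).symm
  have hmarkov := mul_meas_ge_le_integral_of_nonneg
    (Filter.Eventually.of_forall fun z => by positivity) hf (γ ^ p)
  rw [← hset] at hmarkov
  rw [inv_mul_lt_iff₀ hε, mul_comm ε] at hpow
  exact lt_of_mul_lt_mul_left (hmarkov.trans_lt hpow) (by positivity)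

/-- Accuracy guarantee of the hybrid method: if `γ > γ_N = ε^{-1/p} ‖g - ĝ‖_{L^p_μ}`, where
`‖g - ĝ‖_{L^p_μ} = (∫ |g - ĝ|^p dμ)^{1/p}`, then the hybrid failure probability
`P_f^h(γ) = μ({ĝ < -γ} ∪ ({|ĝ| ≤ γ} ∩ {g < 0}))` satisfies `|P_f - P_f^h(γ)| < ε`, where
`P_f = μ({g < 0})` is the true failure probability. -/
theorem hybrid_failure_probability_error_lt {E : Type*} [MeasurableSpace E]
    (μ : Measure E) [IsProbabilityMeasure μ]
    (g ghat : E → ℝ) (hg : Measurable g) (hghat : Measurable ghat)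
    (p : ℝ) (hp : 1 ≤ p)
    (hLp : Integrable (fun z => |g z - ghat z| ^ p) μ)
    (ε : ℝ) (hε : 0 < ε) (γ : ℝ)
    (hγ : γ > ε ^ (-(1 / p)) * (∫ z, |g z - ghat z| ^ p ∂μ) ^ (1 / p)) :
    |(μ {z | g z < 0}).toReal -
        (μ ({z | ghat z < -γ} ∪ ({z | |ghat z| ≤ γ} ∩ {z | g z < 0}))).toReal| < ε := by
  have hp_pos : 0 < p := one_pos.trans_le hp
  have hA : MeasurableSet {z | g z < 0} := measurableSet_lt hg measurable_const
  have hB : MeasurableSet ({z | ghat z < -γ} ∪ ({z | |ghat z| ≤ γ} ∩ {z | g z < 0})) :=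
    (measurableSet_lt hghat measurable_const).union
      ((measurableSet_le hghat.abs measurable_const).inter hA)
  exact ((abs_measureReal_sub_le_measureReal_symmDiff hA.nullMeasurableSet
    hB.nullMeasurableSet).trans
    (measureReal_mono (symmDiff_hybrid_failure_domain_subset g ghat γ))).trans_lt
    (measureReal_abs_ge_lt hp_pos hLp hε hγ)
end
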